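/- Let f : ℂ² → ℂ be an entire function and set V = {z ∈ 𝔻̄² : f(z) = 0}. If V is nonempty, then V ∩ ∂𝔻̄² is nonempty and, for every polynomial function p in the two complex coordinates, sup_{z ∈ V} |p(z)| = sup_{z ∈ V ∩ ∂𝔻̄²} |p(z)|. -/

import Mathlib

noncomputable def pev (q : MvPolynomial (Fin 2) ℂ) (z : ℂ × ℂ) : ℂ :=
  MvPolynomial.eval ![z.1, z.2] q

def bidisk : Set (ℂ × ℂ) := {z : ℂ × ℂ | ‖z.1‖ ≤ 1 ∧ ‖z.2‖ ≤ 1}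

open Metric Set Filter Topology

/-- A nonzero entire function can be divided by the full power of `z - a` at a zero `a`. -/
lemma exists_entire_eq_pow_mul {f : ℂ → ℂ} (hf : Differentiable ℂ f) {b : ℂ} (hb : f b ≠ 0)
    (a : ℂ) : ∃ (n : ℕ) (g : ℂ → ℂ), Differentiable ℂ g ∧ g a ≠ 0 ∧
      ∀ z, f z = (z - a) ^ n * g z := by
  obtain ⟨p, hp⟩ := hf.analyticAt a
  have hp0 : p ≠ 0 := by
    intro h
    have h0 : f =ᶠ[𝓝 a] 0 := hp.locally_zero_iff.mpr h
    have := AnalyticOnNhd.eq_of_eventuallyEq (fun z _ => hf.analyticAt z)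
      (fun z _ => analyticAt_const) h0
    exact hb (congrFun this b)
  refine ⟨p.order, (Function.swap dslope a)^[p.order] f, ?_, hp.iterate_dslope_fslope_ne_zero hp0,
    fun z => hp.eq_pow_order_mul_iterate_dslope z⟩
  generalize p.order = n
  induction n with
  | zero => exact hf
  | succ n ih =>
    rw [Function.iterate_succ_apply', ← differentiableOn_univ]
    exact (Complex.differentiableOn_dslope univ_mem).mpr ih.differentiableOn

lemma circleIntegral_mul_logDeriv_aux {c : ℂ} {r : ℝ} (hr : 0 < r) (Z : Finset ℂ) :
    ∀ f : ℂ → ℂ, Differentiable ℂ f → (∀ z ∈ sphere c r, f z ≠ 0) →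
      (∀ a, a ∈ Z ↔ a ∈ ball c r ∧ f a = 0) →
      ∃ m : ℂ → ℕ, (∀ a ∈ Z, 1 ≤ m a) ∧ ∀ H : ℂ → ℂ, Differentiable ℂ H →
        (∮ z in C(c, r), H z * logDeriv f z) = 2 * Real.pi * Complex.I * ∑ a ∈ Z, m a * H a := by
  induction Z using Finset.induction_on with
  | empty =>
    intro f hf hs hZ
    refine ⟨fun _ => 0, by simp, fun H hH => ?_⟩
    have hne : ∀ z ∈ closedBall c r, f z ≠ 0 := by
      intro z hz
      rcases (mem_closedBall.mp hz).lt_or_eq with h | h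
      · intro h0
        simpa using (hZ z).mpr ⟨h, h0⟩
      · exact hs z h
    have hd : DifferentiableOn ℂ (fun z => H z * logDeriv f z) (closedBall c r) := by
      intro z hz
      have h1 : DifferentiableAt ℂ (deriv f) z := (hf.analyticAt z).deriv.differentiableAt
      exact ((hH z).mul (h1.div (hf z) (hne z hz))).differentiableWithinAt
    rw [(hd.diffContOnCl_ball subset_rfl).circleIntegral_eq_zero hr.le]
    simp
  | insert a Z ha ih =>
    intro f hf hs hZ
    obtain ⟨hab, hfa⟩ := (hZ a).mp (Finset.mem_insert_self a Z)
    obtain ⟨b, hb⟩ : (sphere c r).Nonempty := NormedSpace.sphere_nonempty.mpr hr.le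
    obtain ⟨n, g, hg, hga, hfg⟩ := exists_entire_eq_pow_mul hf (hs b hb) a
    have hn : 1 ≤ n := by
      by_contra h
      obtain rfl : n = 0 := by omega
      exact hga (by simpa [hfa] using (hfg a).symm)
    have hgs : ∀ z ∈ sphere c r, g z ≠ 0 := fun z hz h => hs z hz (by rw [hfg, h, mul_zero])
    have hza : ∀ z ∈ sphere c r, z - a ≠ 0 := by
      intro z hz h
      rw [sub_eq_zero.mp h] at hz
      exact absurd (mem_sphere.mp hz) (mem_ball.mp hab).ne
    obtain ⟨m, hm, hmH⟩ := ih g hg hgs (by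
      intro z
      constructor
      · intro hz
        obtain ⟨h1, h2⟩ := (hZ z).mp (Finset.mem_insert_of_mem hz)
        refine ⟨h1, ?_⟩
        rw [hfg] at h2
        refine (mul_eq_zero.mp h2).resolve_left (pow_ne_zero _ (sub_ne_zero.mpr ?_))
        rintro rfl
        exact ha hz
      · rintro ⟨h1, h2⟩
        have := (hZ z).mpr ⟨h1, by rw [hfg, h2, mul_zero]⟩
        refine (Finset.mem_insert.mp this).resolve_left ?_
        rintro rfl
        exact hga h2)
    refine ⟨Function.update m a n, ?_, fun H hH => ?_⟩
    · intro z hz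
      by_cases h : z = a
      · subst h; simpa using hn
      · simpa [h] using hm z ((Finset.mem_insert.mp hz).resolve_left h)
    have hEq : EqOn (fun z => H z * logDeriv f z)
        (fun z => (z - a)⁻¹ • (n * H z) + H z * logDeriv g z) (sphere c r) := by
      intro z hz
      have hf' : f = fun z => (z - a) ^ n * g z := funext hfg
      have h1 : logDeriv f z = n * (z - a)⁻¹ + logDeriv g z := by
        rw [hf', logDeriv_mul (f := fun z => (z - a) ^ n) z (pow_ne_zero n (hza z hz)) (hgs z hz)
            (by fun_prop) (hg z),
          logDeriv_fun_pow (by fun_prop)]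
        simp [logDeriv_apply]
      simp only [h1, smul_eq_mul]
      ring
    have hc1 : CircleIntegrable (fun z => (z - a)⁻¹ • (n * H z)) c r := by
      refine ContinuousOn.circleIntegrable hr.le ?_
      exact ((continuous_id.sub continuous_const).continuousOn.inv₀ hza).smul
        (continuous_const.mul hH.continuous).continuousOn
    have hc2 : CircleIntegrable (fun z => H z * logDeriv g z) c r := by
      refine ContinuousOn.circleIntegrable hr.le ?_
      have h1 : Continuous (deriv g) :=
        continuous_iff_continuousAt.mpr fun z => (hg.analyticAt z).deriv.continuousAt
      exact hH.continuous.continuousOn.mul (h1.continuousOn.div hg.continuous.continuousOn hgs)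
    rw [circleIntegral.integral_congr hr.le hEq, circleIntegral.integral_add hc1 hc2, hmH H hH,
      DiffContOnCl.circleIntegral_sub_inv_smul
        (Differentiable.diffContOnCl (by fun_prop)) hab, Finset.sum_insert ha]
    have : ∑ x ∈ Z, ((Function.update m a n x : ℕ) : ℂ) * H x = ∑ x ∈ Z, m x * H x :=
      Finset.sum_congr rfl fun x hx => by
        rw [Function.update_of_ne (by rintro rfl; exact ha hx)]
    rw [this, Function.update_self, smul_eq_mul]
    ring

/-- The generalized argument principle for an entire function without zeros on the circle. -/
lemma circleIntegral_mul_logDeriv {c : ℂ} {r : ℝ} (hr : 0 < r) {f : ℂ → ℂ}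
    (hf : Differentiable ℂ f) (hs : ∀ z ∈ sphere c r, f z ≠ 0) :
    ∃ (Z : Finset ℂ) (m : ℂ → ℕ), (∀ a, a ∈ Z ↔ a ∈ ball c r ∧ f a = 0) ∧ (∀ a ∈ Z, 1 ≤ m a) ∧
      ∀ H : ℂ → ℂ, Differentiable ℂ H →
        (∮ z in C(c, r), H z * logDeriv f z) = 2 * Real.pi * Complex.I * ∑ a ∈ Z, m a * H a := by
  have hfin : {a | a ∈ ball c r ∧ f a = 0}.Finite := by
    by_contra hinf
    obtain ⟨x, -, hx⟩ := Set.Infinite.exists_accPt_of_subset_isCompact hinf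
      (isCompact_closedBall c r) (fun a ha => ball_subset_closedBall ha.1)
    rw [accPt_iff_frequently_nhdsNE] at hx
    have h0 := AnalyticOnNhd.eq_of_frequently_eq (f := f) (g := fun _ => 0)
      (fun z _ => hf.analyticAt z) (fun z _ => analyticAt_const) (hx.mono fun z hz => hz.2)
    obtain ⟨b, hb⟩ : (sphere c r).Nonempty := NormedSpace.sphere_nonempty.mpr hr.le
    exact hs b hb (congrFun h0 b)
  have hZ : ∀ a, a ∈ hfin.toFinset ↔ a ∈ ball c r ∧ f a = 0 := by simp
  obtain ⟨m, hm⟩ := circleIntegral_mul_logDeriv_aux hr _ f hf hs hZ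
  exact ⟨_, m, hZ, hm⟩

/-- Fubini and the mean value property: a bound on the circle integrals of `G (·, w)` for `w` on a
circle carries over to the center of that circle. -/
lemma norm_circleIntegral_le_of_sphere {G : ℂ × ℂ → ℂ} {c w₀ : ℂ} {r s B : ℝ} (hr : 0 < r)
    (hs : 0 < s) (hG : ∀ z ∈ sphere c r, ∀ w ∈ closedBall w₀ s, DifferentiableAt ℂ G (z, w))
    (hB : ∀ w ∈ sphere w₀ s, ‖∮ z in C(c, r), G (z, w)‖ ≤ B) :
    ‖∮ z in C(c, r), G (z, w₀)‖ ≤ B := by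
  have hmean : ∀ z ∈ sphere c r, Real.circleAverage (fun w => G (z, w)) w₀ s = G (z, w₀) := by
    intro z hz
    refine DiffContOnCl.circleAverage (f := fun w => G (z, w)) ?_
    rw [abs_of_pos hs]
    refine DifferentiableOn.diffContOnCl_ball (U := closedBall w₀ s) (fun w hw => ?_) subset_rfl
    exact ((hG z hz w hw).comp w (by fun_prop : DifferentiableAt ℂ (fun w => (z, w)) w)
      ).differentiableWithinAt
  have hcont : Continuous fun x : ℝ × ℝ =>
      deriv (circleMap c r) x.1 • G (circleMap c r x.1, circleMap w₀ s x.2) := by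
    simp only [deriv_circleMap]
    have hd : Continuous fun x : ℝ × ℝ => circleMap 0 r x.1 * Complex.I := by fun_prop
    refine hd.smul (continuous_iff_continuousAt.mpr fun x => ?_)
    have h : Continuous fun x : ℝ × ℝ => (circleMap c r x.1, circleMap w₀ s x.2) := by fun_prop
    exact ContinuousAt.comp (g := G) (f := fun x : ℝ × ℝ => (circleMap c r x.1, circleMap w₀ s x.2))
      (hG _ (circleMap_mem_sphere c hr.le _) _
        (circleMap_mem_closedBall w₀ hs.le _)).continuousAt h.continuousAt
  have hswap : (∮ z in C(c, r), G (z, w₀)) =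
      Real.circleAverage (fun w => ∮ z in C(c, r), G (z, w)) w₀ s := by
    rw [← circleIntegral.integral_congr hr.le hmean]
    simp only [circleIntegral, Real.circleAverage_def]
    rw [← MeasureTheory.intervalIntegral_intervalIntegral_swap
      (F := fun x y => deriv (circleMap c r) x • G (circleMap c r x, circleMap w₀ s y)),
      ← intervalIntegral.integral_smul]
    · refine intervalIntegral.integral_congr fun θ _ => ?_
      simp only [intervalIntegral.integral_smul]
      rw [smul_comm]
    · refine (hcont.continuousOn.integrableOn_compact
        (isCompact_uIcc.prod isCompact_uIcc)).mono_set
          (prod_mono uIoc_subset_uIcc uIoc_subset_uIcc)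
  rw [hswap, Real.circleAverage_def, norm_smul]
  have h1 := intervalIntegral.norm_integral_le_of_norm_le_const (a := 0) (b := 2 * Real.pi)
    (f := fun θ => ∮ z in C(c, r), G (z, circleMap w₀ s θ)) (C := B)
    (fun θ _ => hB _ (circleMap_mem_sphere w₀ hs.le θ))
  have hpi := Real.two_pi_pos
  rw [sub_zero, abs_of_pos hpi] at h1
  rw [norm_inv, Real.norm_of_nonneg hpi.le, inv_mul_le_iff₀ hpi]
  linarith

/-- A local maximum principle on the zero set of `f`, near an isolated zero of `f (·, w₀)`. -/
lemma norm_le_of_isolated_zero {f F : ℂ × ℂ → ℂ} (hf : ∀ z, AnalyticAt ℂ f z)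
    (hF : Differentiable ℂ F) {z₀ w₀ : ℂ} {r s q : ℝ} (hr : 0 < r) (hs : 0 < s)
    (hq0 : 0 ≤ q) (h0 : f (z₀, w₀) = 0) (hiso : ∀ z ∈ ball z₀ r, f (z, w₀) = 0 → z = z₀)
    (hne : ∀ z ∈ sphere z₀ r, ∀ w ∈ closedBall w₀ s, f (z, w) ≠ 0)
    (hq : ∀ w ∈ sphere w₀ s, ∀ z ∈ ball z₀ r, f (z, w) = 0 → ‖F (z, w)‖ ≤ q) :
    ‖F (z₀, w₀)‖ ≤ q := by
  by_contra! hlt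
  have hpos : 0 < ‖F (z₀, w₀)‖ := hq0.trans_lt hlt
  have hfd : Differentiable ℂ f := fun z => (hf z).differentiableAt
  have hslice : ∀ w, Differentiable ℂ fun z => f (z, w) := fun w => by fun_prop
  set L : ℂ × ℂ → ℂ := fun x => fderiv ℂ f x (1, 0) * (f x)⁻¹ with hL
  have hLlog : ∀ z w, logDeriv (fun z => f (z, w)) z = L (z, w) := by
    intro z w
    have h1 : HasDerivAt (fun z : ℂ => (z, w)) ((1 : ℂ), (0 : ℂ)) z :=
      (hasDerivAt_id z).prodMk (hasDerivAt_const z w)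
    have h2 := (hfd (z, w)).hasFDerivAt.comp_hasDerivAt z h1
    rw [logDeriv_apply, div_eq_mul_inv]
    exact congrArg (· * (f (z, w))⁻¹) h2.deriv
  have hLd : ∀ z ∈ sphere z₀ r, ∀ w ∈ closedBall w₀ s, DifferentiableAt ℂ L (z, w) := by
    intro z hz w hw
    have h1 : DifferentiableAt ℂ (fderiv ℂ f) (z, w) := (hf _).fderiv.differentiableAt
    exact (h1.clm_apply (differentiableAt_const _)).mul ((hfd _).inv (hne z hz w hw))
  have hI : ∀ w ∈ closedBall w₀ s, ∃ (Z : Finset ℂ) (m : ℂ → ℕ),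
      (∀ a, a ∈ Z ↔ a ∈ ball z₀ r ∧ f (a, w) = 0) ∧ (∀ a ∈ Z, 1 ≤ m a) ∧
      ∀ n : ℕ, (∮ z in C(z₀, r), F (z, w) ^ n * L (z, w)) =
        2 * Real.pi * Complex.I * ∑ a ∈ Z, m a * F (a, w) ^ n := by
    intro w hw
    obtain ⟨Z, m, hZ, hm, hH⟩ := circleIntegral_mul_logDeriv hr (hslice w)
      (fun z hz => hne z hz w hw)
    refine ⟨Z, m, hZ, hm, fun n => ?_⟩
    rw [← hH (fun z => F (z, w) ^ n) (by fun_prop)]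
    simp only [hLlog]
  obtain ⟨B, hB⟩ := ((isCompact_sphere z₀ r).prod
    (isCompact_sphere w₀ s)).exists_bound_of_continuousOn (f := L) (fun x hx =>
      (hLd x.1 hx.1 x.2 (sphere_subset_closedBall hx.2)).continuousAt.continuousWithinAt)
  have hpi : ‖(2 * Real.pi * Complex.I : ℂ)‖ = 2 * Real.pi := by
    simp [abs_of_pos Real.pi_pos]
  have hbound : ∀ n : ℕ, ∀ w ∈ sphere w₀ s,
      ‖∮ z in C(z₀, r), F (z, w) ^ n * L (z, w)‖ ≤ 2 * Real.pi * r * B * q ^ n := by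
    intro n w hw
    obtain ⟨Z, m, hZ, hm, hn⟩ := hI w (sphere_subset_closedBall hw)
    have hc := circleIntegral.norm_integral_le_of_norm_le_const (c := z₀)
      (f := fun z => F (z, w) ^ 0 * L (z, w)) hr.le
      (C := B) (fun z hz => by simpa using hB (z, w) ⟨hz, hw⟩)
    have hcast : (∑ a ∈ Z, (m a : ℂ) * F (a, w) ^ 0) = ((∑ a ∈ Z, (m a : ℝ) : ℝ) : ℂ) := by
      push_cast; simp
    rw [hn 0, hcast, norm_mul, Complex.norm_of_nonneg
      (Finset.sum_nonneg fun a _ => Nat.cast_nonneg (m a))] at hc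
    have hsum : ‖∑ a ∈ Z, (m a : ℂ) * F (a, w) ^ n‖ ≤ (∑ a ∈ Z, (m a : ℝ)) * q ^ n := by
      rw [Finset.sum_mul]
      refine (norm_sum_le _ _).trans (Finset.sum_le_sum fun a ha => ?_)
      obtain ⟨h1, h2⟩ := (hZ a).mp ha
      rw [norm_mul, norm_pow, Complex.norm_natCast]
      gcongr
      exact hq w hw a h1 h2
    rw [hn n, norm_mul, hpi]
    rw [hpi] at hc
    calc _ ≤ 2 * Real.pi * ((∑ a ∈ Z, (m a : ℝ)) * q ^ n) := by gcongr
      _ = (2 * Real.pi * ∑ a ∈ Z, (m a : ℝ)) * q ^ n := by ring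
      _ ≤ _ := by gcongr
  obtain ⟨Z, m, hZ, hm, hn⟩ := hI w₀ (mem_closedBall_self hs.le)
  have hZ0 : Z = {z₀} := by
    ext a
    rw [hZ, Finset.mem_singleton]
    exact ⟨fun h => hiso a h.1 h.2, by rintro rfl; exact ⟨mem_ball_self hr, h0⟩⟩
  subst hZ0
  have key : ∀ n : ℕ, 1 ≤ 2 * Real.pi * r * B * (q / ‖F (z₀, w₀)‖) ^ n := by
    intro n
    have h1 := norm_circleIntegral_le_of_sphere (G := fun x => F x ^ n * L x) hr hs
      (fun z hz w hw => ((hF _).pow n).mul (hLd z hz w hw)) (hbound n)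
    rw [hn n, Finset.sum_singleton, norm_mul, hpi, norm_mul, norm_pow, Complex.norm_natCast] at h1
    have hm1 : (1 : ℝ) ≤ m z₀ := by exact_mod_cast hm z₀ (Finset.mem_singleton_self _)
    have hpi1 : (1 : ℝ) ≤ 2 * Real.pi := by linarith [Real.pi_gt_three]
    have hp : 0 < ‖F (z₀, w₀)‖ ^ n := pow_pos hpos n
    rw [div_pow, ← mul_div_assoc, one_le_div hp]
    refine le_trans ?_ h1
    rw [← mul_assoc]
    exact le_mul_of_one_le_left hp.le (one_le_mul_of_one_le_of_one_le hpi1 hm1)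
  have hlim := (tendsto_pow_atTop_nhds_zero_of_lt_one (div_nonneg hq0 hpos.le)
    ((div_lt_one hpos).mpr hlt)).const_mul (2 * Real.pi * r * B)
  rw [mul_zero] at hlim
  exact absurd (ge_of_tendsto' hlim key) (by norm_num)

lemma bidisk_eq_closedBall : bidisk = closedBall (0 : ℂ × ℂ) 1 := by
  ext x
  simp [bidisk, Prod.norm_def]

lemma mem_frontier_bidisk {x : ℂ × ℂ} : x ∈ frontier bidisk ↔ max ‖x.1‖ ‖x.2‖ = 1 := by
  rw [bidisk_eq_closedBall, frontier_closedBall _ one_ne_zero, mem_sphere_zero_iff_norm,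
    Prod.norm_def]

/-- If `‖g‖ exp (ε ‖w‖²)` attains a nonzero maximum over the zero set of `f` in the bidisk, then
it also attains it at a boundary point. -/
lemma exists_frontier_of_isMaxOn {f g : ℂ × ℂ → ℂ} (hf : ∀ z, AnalyticAt ℂ f z)
    (hg : Differentiable ℂ g) {ε : ℝ} (hε : 0 < ε) {x₀ : ℂ × ℂ} (hx₀ : x₀ ∈ bidisk)
    (hfx₀ : f x₀ = 0) (hgx₀ : g x₀ ≠ 0)
    (hmax : ∀ x ∈ bidisk, f x = 0 →
      ‖g x‖ * Real.exp (ε * ‖x.2‖ ^ 2) ≤ ‖g x₀‖ * Real.exp (ε * ‖x₀.2‖ ^ 2)) :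
    ∃ x ∈ frontier bidisk, f x = 0 ∧
      ‖g x₀‖ * Real.exp (ε * ‖x₀.2‖ ^ 2) ≤ ‖g x‖ * Real.exp (ε * ‖x.2‖ ^ 2) := by
  by_cases hfr : x₀ ∈ frontier bidisk
  · exact ⟨x₀, hfr, hfx₀, le_rfl⟩
  obtain ⟨z₀, w₀⟩ := x₀
  have hlt : ‖z₀‖ < 1 ∧ ‖w₀‖ < 1 :=
    max_lt_iff.mp ((max_le hx₀.1 hx₀.2).lt_of_ne fun h => hfr (mem_frontier_bidisk.mpr h))
  obtain ⟨hz₀, hw₀⟩ := hlt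
  have hslice : ∀ w, Differentiable ℂ fun z => f (z, w) := fun w => by
    have hfd : Differentiable ℂ f := fun z => (hf z).differentiableAt
    fun_prop
  rcases ((hslice w₀).analyticAt z₀).eventually_eq_zero_or_eventually_ne_zero with h0 | h0
  · have hzero := AnalyticOnNhd.eq_of_eventuallyEq (f := fun z => f (z, w₀)) (g := fun _ => 0)
      (fun z _ => (hslice w₀).analyticAt z) (fun z _ => analyticAt_const) h0
    obtain ⟨z, hz, hzmax⟩ := Complex.exists_mem_frontier_isMaxOn_norm
      (f := fun z => g (z, w₀)) (U := ball (0 : ℂ) 1) isBounded_ball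
      (nonempty_ball.mpr one_pos) (Differentiable.diffContOnCl (by fun_prop))
    rw [frontier_ball _ one_ne_zero, mem_sphere_zero_iff_norm] at hz
    refine ⟨(z, w₀), mem_frontier_bidisk.mpr (by simp [hz, hw₀.le]), congrFun hzero z, ?_⟩
    have := hzmax (subset_closure (mem_ball_zero_iff.mpr hz₀))
    simp only [mem_ofPred_eq, Function.comp_apply] at this
    dsimp only
    gcongr
  · exfalso
    rw [eventually_nhdsWithin_iff, Metric.eventually_nhds_iff_ball] at h0
    obtain ⟨δ, hδ, hball⟩ := h0
    obtain ⟨r, hr, hrlt⟩ := exists_between (lt_min hδ (sub_pos.mpr hz₀))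
    obtain ⟨hrδ, hr1⟩ := lt_min_iff.mp hrlt
    have hev : ∀ᶠ w in 𝓝 w₀, ∀ z ∈ sphere z₀ r, f (z, w) ≠ 0 := by
      refine (isCompact_sphere z₀ r).eventually_forall_of_forall_eventually fun z hz => ?_
      have hc : ContinuousAt (fun x : ℂ × ℂ => f (x.2, x.1)) (w₀, z) :=
        ContinuousAt.comp (g := f) (f := fun x : ℂ × ℂ => (x.2, x.1)) (hf _).continuousAt
          (by fun_prop)
      refine hc.eventually_ne (hball z ?_ ?_)
      · rw [mem_ball, mem_sphere.mp hz]; exact hrδ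
      · exact ne_of_mem_sphere hz hr.ne'
    obtain ⟨η, hη, hηball⟩ := Metric.eventually_nhds_iff_ball.mp hev
    obtain ⟨s, hs, hslt⟩ := exists_between (lt_min hη (sub_pos.mpr hw₀))
    obtain ⟨hsη, hs1⟩ := lt_min_iff.mp hslt
    have hgpos : 0 < ‖g (z₀, w₀)‖ := norm_pos_iff.mpr hgx₀
    have hle := norm_le_of_isolated_zero hf
      (F := fun x => g x * Complex.exp (2 * ε * ((starRingEnd ℂ) w₀ * (x.2 - w₀))))
      (by fun_prop) (q := ‖g (z₀, w₀)‖ * Real.exp (-(ε * s ^ 2))) hr hs (by positivity) hfx₀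
      (fun z hz h => by
        by_contra hne
        exact hball z (ball_subset_ball hrδ.le hz) hne h)
      (fun z hz w hw => hηball w (closedBall_subset_ball hsη hw) z hz) ?_
    · simp only [sub_self, mul_zero, Complex.exp_zero, mul_one] at hle
      have : Real.exp (-(ε * s ^ 2)) < 1 := Real.exp_lt_one_iff.2 (by
        have : 0 < ε * s ^ 2 := by positivity
        linarith)
      nlinarith
    · intro w hw z hz hfz
      have hws : ‖w - w₀‖ = s := mem_sphere_iff_norm.mp hw
      have hzs : ‖z - z₀‖ < r := mem_ball_iff_norm.mp hz
      have hin : (z, w) ∈ bidisk := by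
        constructor
        · have := norm_le_norm_add_norm_sub' z z₀
          dsimp only
          linarith
        · have := norm_le_norm_add_norm_sub' w w₀
          dsimp only
          linarith
      have hm := hmax _ hin hfz
      have hsq : ‖w‖ ^ 2 = ‖w₀‖ ^ 2 + 2 * ((starRingEnd ℂ) w₀ * (w - w₀)).re + s ^ 2 := by
        rw [← hws, Complex.sq_norm, Complex.sq_norm, Complex.sq_norm]
        simp [Complex.normSq_apply]
        ring
      have hre : (2 * ε * ((starRingEnd ℂ) w₀ * (w - w₀)) : ℂ).re =
          ε * ‖w‖ ^ 2 - ε * ‖w₀‖ ^ 2 - ε * s ^ 2 := by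
        have h2 : (2 * ε : ℂ) = ((2 * ε : ℝ) : ℂ) := by push_cast; rfl
        rw [h2, Complex.re_ofReal_mul, hsq]
        ring
      dsimp only at hm ⊢
      rw [norm_mul, Complex.norm_exp, hre]
      calc ‖g (z, w)‖ * Real.exp (ε * ‖w‖ ^ 2 - ε * ‖w₀‖ ^ 2 - ε * s ^ 2)
          = (‖g (z, w)‖ * Real.exp (ε * ‖w‖ ^ 2)) *
              (Real.exp (-(ε * ‖w₀‖ ^ 2)) * Real.exp (-(ε * s ^ 2))) := by
            rw [mul_assoc, ← Real.exp_add, ← Real.exp_add]; ring_nf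
        _ ≤ (‖g (z₀, w₀)‖ * Real.exp (ε * ‖w₀‖ ^ 2)) *
              (Real.exp (-(ε * ‖w₀‖ ^ 2)) * Real.exp (-(ε * s ^ 2))) := by gcongr
        _ = ‖g (z₀, w₀)‖ * Real.exp (-(ε * s ^ 2)) := by
            rw [mul_assoc, ← Real.exp_add, ← Real.exp_add]; ring_nf

/-- The maximum principle on the zero set of an entire function in the bidisk. -/
lemma exists_frontier_norm_le {f g : ℂ × ℂ → ℂ} (hf : ∀ z, AnalyticAt ℂ f z)
    (hg : Differentiable ℂ g) {x₀ : ℂ × ℂ} (hx₀ : x₀ ∈ bidisk) (hfx₀ : f x₀ = 0)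
    (hgx₀ : g x₀ ≠ 0) : ∃ x ∈ frontier bidisk, f x = 0 ∧ ‖g x₀‖ ≤ ‖g x‖ := by
  by_contra! hcon
  have hfc : Continuous f := continuous_iff_continuousAt.mpr fun z => (hf z).continuousAt
  have hgc : Continuous g := hg.continuous
  have hcpt : IsCompact bidisk := bidisk_eq_closedBall ▸ isCompact_closedBall _ _
  have hsub : frontier bidisk ⊆ bidisk := hcpt.isClosed.frontier_subset
  have hpos : 0 < ‖g x₀‖ := norm_pos_iff.mpr hgx₀
  obtain ⟨m, hm, hmb⟩ : ∃ m < ‖g x₀‖, ∀ x ∈ frontier bidisk, f x = 0 → ‖g x‖ ≤ m := by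
    have hK : IsCompact (frontier bidisk ∩ {x | f x = 0}) :=
      (hcpt.of_isClosed_subset isClosed_frontier hsub).inter_right
        (isClosed_singleton.preimage hfc)
    rcases (frontier bidisk ∩ {x | f x = 0}).eq_empty_or_nonempty with he | hne
    · refine ⟨0, hpos, fun x hx hfx => ?_⟩
      have : x ∈ frontier bidisk ∩ {x | f x = 0} := ⟨hx, hfx⟩
      simp [he] at this
    · obtain ⟨b, hb, hbmax⟩ := hK.exists_isMaxOn hne hgc.norm.continuousOn
      exact ⟨‖g b‖, hcon b hb.1 hb.2, fun x hx hfx => hbmax ⟨hx, hfx⟩⟩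
  obtain ⟨ε, hεm, hε⟩ : ∃ ε : ℝ, m * Real.exp ε < ‖g x₀‖ ∧ 0 < ε := by
    have hc : ContinuousAt (fun ε : ℝ => m * Real.exp ε) 0 := by fun_prop
    have h1 : ∀ᶠ ε : ℝ in 𝓝[>] 0, m * Real.exp ε < ‖g x₀‖ :=
      nhdsWithin_le_nhds (hc.eventually_lt_const (by simpa using hm))
    exact (h1.and self_mem_nhdsWithin).exists
  obtain ⟨y, hy, hymax⟩ := (hcpt.inter_right (isClosed_singleton.preimage hfc)).exists_isMaxOn
    (f := fun x => ‖g x‖ * Real.exp (ε * ‖x.2‖ ^ 2)) ⟨x₀, hx₀, hfx₀⟩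
    (Continuous.continuousOn (by fun_prop))
  have hbig : ‖g x₀‖ ≤ ‖g y‖ * Real.exp (ε * ‖y.2‖ ^ 2) :=
    (le_mul_of_one_le_right hpos.le (Real.one_le_exp (by positivity))).trans
      (hymax ⟨hx₀, hfx₀⟩)
  have hgy : g y ≠ 0 := by
    intro h
    rw [h, norm_zero, zero_mul] at hbig
    exact absurd hbig hpos.not_ge
  obtain ⟨b, hb, hfb, hyb⟩ := exists_frontier_of_isMaxOn hf hg hε hy.1 hy.2 hgy
    (fun x hx hfx => hymax ⟨hx, hfx⟩)
  have hb2 : ‖b.2‖ ≤ 1 := (hsub hb).2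
  have : ‖g b‖ * Real.exp (ε * ‖b.2‖ ^ 2) ≤ m * Real.exp ε := by
    have h1 : ε * ‖b.2‖ ^ 2 ≤ ε := mul_le_of_le_one_right hε.le (pow_le_one₀ (norm_nonneg _) hb2)
    have h2 := hmb b hb hfb
    have h3 : 0 ≤ m := (norm_nonneg _).trans h2
    gcongr
  linarith

lemma differentiable_pev (q : MvPolynomial (Fin 2) ℂ) : Differentiable ℂ (pev q) := by
  unfold pev
  induction q using MvPolynomial.induction_on with
  | C a => simp
  | add p q hp hq => simpa using hp.fun_add hq
  | mul_X p i hp =>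
    have hi : Differentiable ℂ fun z : ℂ × ℂ => (![z.1, z.2] : Fin 2 → ℂ) i := by
      fin_cases i
      · exact differentiable_fst
      · exact differentiable_snd
    simpa using hp.fun_mul hi

/-- Let `f : ℂ² → ℂ` be entire and `V = {z ∈ 𝔻̄² : f z = 0}`. If `V` is nonempty, then
`V ∩ ∂𝔻̄²` is nonempty and, for every polynomial function `p` in the two complex
coordinates, `sup_{z ∈ V} |p z| = sup_{z ∈ V ∩ ∂𝔻̄²} |p z|`. -/
theorem stmt6 (f : ℂ × ℂ → ℂ) (hf : ∀ z : ℂ × ℂ, AnalyticAt ℂ f z)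
    (V : Set (ℂ × ℂ)) (hV : V = {z ∈ bidisk | f z = 0}) (hne : V.Nonempty) :
    (V ∩ frontier bidisk).Nonempty ∧
      ∀ q : MvPolynomial (Fin 2) ℂ,
        sSup ((fun z => ‖pev q z‖) '' V) =
          sSup ((fun z => ‖pev q z‖) '' (V ∩ frontier bidisk)) := by
  subst hV
  obtain ⟨x₀, hx₀, hfx₀⟩ := hne
  have hcpt : IsCompact bidisk := bidisk_eq_closedBall ▸ isCompact_closedBall _ _
  have hsub : frontier bidisk ⊆ bidisk := hcpt.isClosed.frontier_subset
  have hnonempty : ({z ∈ bidisk | f z = 0} ∩ frontier bidisk).Nonempty := by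
    obtain ⟨b, hb, hfb, -⟩ := exists_frontier_norm_le hf (g := fun _ => 1)
      (differentiable_const _) hx₀ hfx₀ one_ne_zero
    exact ⟨b, ⟨hsub hb, hfb⟩, hb⟩
  refine ⟨hnonempty, fun q => ?_⟩
  have hbdd : BddAbove ((fun z => ‖pev q z‖) '' {z ∈ bidisk | f z = 0}) :=
    (hcpt.bddAbove_image (differentiable_pev q).continuous.norm.continuousOn).mono
      (image_mono (sep_subset _ _))
  have hbdd' : BddAbove ((fun z => ‖pev q z‖) '' ({z ∈ bidisk | f z = 0} ∩ frontier bidisk)) :=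
    hbdd.mono (image_mono inter_subset_left)
  refine le_antisymm (csSup_le (Nonempty.image _ ⟨x₀, hx₀, hfx₀⟩) ?_)
    (csSup_le_csSup hbdd (hnonempty.image _) (image_mono inter_subset_left))
  rintro _ ⟨x, ⟨hx, hfx⟩, rfl⟩
  dsimp only
  by_cases hqx : pev q x = 0
  · rw [hqx, norm_zero]
    exact Real.sSup_nonneg (by rintro _ ⟨z, -, rfl⟩; exact norm_nonneg _)
  · obtain ⟨b, hb, hfb, hle⟩ := exists_frontier_norm_le hf (differentiable_pev q) hx hfx hqx
    exact hle.trans (le_csSup hbdd' ⟨b, ⟨⟨hsub hb, hfb⟩, hb⟩, rfl⟩)
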